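/- Let τ₁, τ₂ be nonzero complex numbers and z₁, z₃ arbitrary complex numbers. Let D be the 8×8 complex diagonal matrix diag(z₁, z₁, z₃, z₃, z₁, z₁, z₃, z₃), and let S be the 8×8 complex matrix with rows: (0,0,0,0,−1/2,1/2,1/2,1/2), (0,0,0,0,1/2,−1/2,1/2,1/2), (0,0,0,0,1/2,1/2,−1/2,1/2), (0,0,0,0,1/2,1/2,1/2,−1/2), (0,τ₁⁻¹,0,0,0,0,0,0), (τ₁,0,0,0,0,0,0,0), (0,0,0,τ₂⁻¹,0,0,0,0), (0,0,τ₂,0,0,0,0,0). Then det(I₈ − S·D) = 1 − (1/2)(τ₁+τ₁⁻¹)z₁² − (1/2)(τ₂+τ₂⁻¹)z₃² + (1/2)(τ₁+τ₁⁻¹)z₁²z₃⁴ + (1/2)(τ₂+τ₂⁻¹)z₁⁴z₃² − z₁⁴z₃⁴. -/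

import Mathlib

open Matrix

/-- **The secular determinant (5.18) of the quotient graph `Γ_{n₁}□Γ_{n₂}/τ_{s,t}`**:
with bond scattering matrix `S`, edge phase matrix `D = diag(z₁,z₁,z₃,z₃,z₁,z₁,z₃,z₃)`
(`z₁ = e^{ikL₁}`, `z₃ = e^{ikL₃}`) and character values `τ₁, τ₂ ≠ 0`,
`det(I − S·D) = 1 − ½(τ₁+τ₁⁻¹)z₁² − ½(τ₂+τ₂⁻¹)z₃² + ½(τ₁+τ₁⁻¹)z₁²z₃⁴
  + ½(τ₂+τ₂⁻¹)z₁⁴z₃² − z₁⁴z₃⁴`. -/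
theorem secular_determinant_quotient (τ₁ τ₂ z₁ z₃ : ℂ) (h₁ : τ₁ ≠ 0) (h₂ : τ₂ ≠ 0) :
    Matrix.det
      ((1 : Matrix (Fin 8) (Fin 8) ℂ) -
        (!![0, 0, 0, 0, -(1/2), 1/2, 1/2, 1/2;
            0, 0, 0, 0, 1/2, -(1/2), 1/2, 1/2;
            0, 0, 0, 0, 1/2, 1/2, -(1/2), 1/2;
            0, 0, 0, 0, 1/2, 1/2, 1/2, -(1/2);
            0, τ₁⁻¹, 0, 0, 0, 0, 0, 0;
            τ₁, 0, 0, 0, 0, 0, 0, 0;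
            0, 0, 0, τ₂⁻¹, 0, 0, 0, 0;
            0, 0, τ₂, 0, 0, 0, 0, 0] *
          Matrix.diagonal ![z₁, z₁, z₃, z₃, z₁, z₁, z₃, z₃])) =
      1 - (1/2) * (τ₁ + τ₁⁻¹) * z₁ ^ 2 - (1/2) * (τ₂ + τ₂⁻¹) * z₃ ^ 2
        + (1/2) * (τ₁ + τ₁⁻¹) * z₁ ^ 2 * z₃ ^ 4
        + (1/2) * (τ₂ + τ₂⁻¹) * z₁ ^ 4 * z₃ ^ 2
        - z₁ ^ 4 * z₃ ^ 4 := by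
  have h1 : (1 : Matrix (Fin 4) (Fin 4) ℂ) = !![1,0,0,0;0,1,0,0;0,0,1,0;0,0,0,1] := by
    ext i j
    fin_cases i <;> fin_cases j <;> simp
  have hE : Matrix.reindex (finSumFinEquiv (m := 4) (n := 4)) (finSumFinEquiv (m := 4) (n := 4))
        (Matrix.fromBlocks 1
          !![z₁/2, -z₁/2, -z₃/2, -z₃/2;
             -z₁/2, z₁/2, -z₃/2, -z₃/2;
             -z₁/2, -z₁/2, z₃/2, -z₃/2;
             -z₁/2, -z₁/2, -z₃/2, z₃/2]
          !![0, -(τ₁⁻¹*z₁), 0, 0;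
             -(τ₁*z₁), 0, 0, 0;
             0, 0, 0, -(τ₂⁻¹*z₃);
             0, 0, -(τ₂*z₃), 0] 1) =
      !![1, 0, 0, 0, z₁/2, -z₁/2, -z₃/2, -z₃/2;
         0, 1, 0, 0, -z₁/2, z₁/2, -z₃/2, -z₃/2;
         0, 0, 1, 0, -z₁/2, -z₁/2, z₃/2, -z₃/2;
         0, 0, 0, 1, -z₁/2, -z₁/2, -z₃/2, z₃/2;
         0, -(τ₁⁻¹*z₁), 0, 0, 1, 0, 0, 0;
         -(τ₁*z₁), 0, 0, 0, 0, 1, 0, 0;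
         0, 0, 0, -(τ₂⁻¹*z₃), 0, 0, 1, 0;
         0, 0, -(τ₂*z₃), 0, 0, 0, 0, 1] := by
    rw [h1]
    ext i j
    fin_cases i <;> fin_cases j <;> rfl
  have hM : ((1 : Matrix (Fin 8) (Fin 8) ℂ) -
        (!![0, 0, 0, 0, -(1/2), 1/2, 1/2, 1/2;
            0, 0, 0, 0, 1/2, -(1/2), 1/2, 1/2;
            0, 0, 0, 0, 1/2, 1/2, -(1/2), 1/2;
            0, 0, 0, 0, 1/2, 1/2, 1/2, -(1/2);
            0, τ₁⁻¹, 0, 0, 0, 0, 0, 0;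
            τ₁, 0, 0, 0, 0, 0, 0, 0;
            0, 0, 0, τ₂⁻¹, 0, 0, 0, 0;
            0, 0, τ₂, 0, 0, 0, 0, 0] *
          Matrix.diagonal ![z₁, z₁, z₃, z₃, z₁, z₁, z₃, z₃])) =
      Matrix.reindex (finSumFinEquiv (m := 4) (n := 4)) (finSumFinEquiv (m := 4) (n := 4))
        (Matrix.fromBlocks 1
          !![z₁/2, -z₁/2, -z₃/2, -z₃/2;
             -z₁/2, z₁/2, -z₃/2, -z₃/2;
             -z₁/2, -z₁/2, z₃/2, -z₃/2;
             -z₁/2, -z₁/2, -z₃/2, z₃/2]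
          !![0, -(τ₁⁻¹*z₁), 0, 0;
             -(τ₁*z₁), 0, 0, 0;
             0, 0, 0, -(τ₂⁻¹*z₃);
             0, 0, -(τ₂*z₃), 0] 1) := by
    rw [hE]
    ext i j
    rw [Matrix.sub_apply, Matrix.mul_diagonal, Matrix.one_apply]
    fin_cases i <;> fin_cases j <;> simp <;> ring
  rw [hM, Matrix.det_reindex_self, Matrix.det_fromBlocks_one₁₁]
  simp [Matrix.det_succ_row_zero, Fin.sum_univ_succ, Matrix.one_apply, Fin.succAbove]
  field_simp
  ring
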